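/- Let (X, ν, d) and (Y, μ, d') be computable metric spaces* in which ν and μ are numberings (onto), and let f : X → Y be a (ν,μ)-computable function. Then f is effectively metric continuous if and only if f is effectively continuous with respect to the metric Nogina topologies on X and Y, i.e. the Nogina topologies generated by the open balls centered at computable points with computable radii, viewed as Nogina bases (with the actual inclusion as formal inclusion on names of open sets). -/

import Mathlib

namespace T1

/-- `phi e` : the `e`-th partial computable function `ℕ ⇀ ℕ`. -/
def phi (e : ℕ) : ℕ →. ℕ :=
  Nat.Partrec.Code.eval (Denumerable.ofNat Nat.Partrec.Code e)

/-- `W e` : the `e`-th computably enumerable subset of `ℕ`. -/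
def W (e : ℕ) : Set ℕ := (phi e).Dom

/-- A canonical numbering of the rationals. -/
def ratOfNat (k : ℕ) : ℚ := (Encodable.decode (α := ℚ) k).getD 0

/-- `e` is a name of `A ⊆ X` as a `ν`-semi-decidable set (a `ν_SD,m`-name):
`phi e` halts on a `ν`-name exactly when the named point belongs to `A`. -/
def SemiDecName {X : Type*} (ν : ℕ →. X) (A : Set X) (e : ℕ) : Prop :=
  ∀ i x, x ∈ ν i → ((phi e i).Dom ↔ x ∈ A)

/-- `f : X → Y` is `(ν,μ)`-computable. -/
def Computes {X Y : Type*} (ν : ℕ →. X) (μ : ℕ →. Y) (f : X → Y) : Prop :=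
  ∃ F : ℕ →. ℕ, Nat.Partrec F ∧ ∀ n x, x ∈ ν n → ∃ m ∈ F n, f x ∈ μ m

/-- `r` is a formal inclusion relation for the naming relation `β` of a family of
subsets of `X`: reflexive (on names), transitive, and implying actual inclusion. -/
structure IsFormalIncl {X : Type*} (β : ℕ → Set X → Prop) (r : ℕ → ℕ → Prop) : Prop where
  refl : ∀ n A, β n A → r n n
  trans : ∀ a b c, r a b → r b c → r a c
  mono : ∀ n m A B, r n m → β n A → β m B → A ⊆ B

/-- Extension of a formal inclusion relation: a name vs. a sequence of names. -/
def SeqIncl (r : ℕ → ℕ → Prop) (b : ℕ) (s : ℕ → ℕ) : Prop := ∃ k, r b (s k)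

/-- Extension of a formal inclusion relation: sequence vs. sequence. -/
def SeqIncl₂ (r : ℕ → ℕ → Prop) (s t : ℕ → ℕ) : Prop := ∀ p, SeqIncl r (s p) t

/-- The equivalence induced by the extended formal inclusion on sequences. -/
def SeqEquiv (r : ℕ → ℕ → Prop) (s t : ℕ → ℕ) : Prop := SeqIncl₂ r s t ∧ SeqIncl₂ r t s

/-- A Type 1 computable topological space `(X, ν, T, τ, r)`, where `τ` is a
(single-valued) naming relation for open sets and `r` a formal inclusion relation. -/
structure IsCTS {X : Type*} (ν : ℕ →. X) (T : TopologicalSpace X)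
    (τ : ℕ → Set X → Prop) (r : ℕ → ℕ → Prop) : Prop where
  single : ∀ n A B, τ n A → τ n B → A = B
  formal : IsFormalIncl τ r
  isOpen : ∀ n A, τ n A → T.IsOpen A
  generates : T = TopologicalSpace.generateFrom {A | ∃ n, τ n A}
  empty : ∃ n, τ n (∅ : Set X)
  univ : ∃ n, τ n (Set.univ : Set X)
  malcev : ∃ F : ℕ →. ℕ, Nat.Partrec F ∧ ∀ n A, τ n A → ∃ e ∈ F n, SemiDecName ν A e
  union : ∃ U : ℕ →. ℕ, Nat.Partrec U ∧
    (∀ c (s : ℕ → ℕ) (A : ℕ → Set X), (∀ k, s k ∈ phi c k) → (∀ k, τ (s k) (A k)) →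
      ∃ u ∈ U c, τ u (⋃ k, A k) ∧ ∀ k, r (s k) u) ∧
    (∀ c (s : ℕ → ℕ) (A : ℕ → Set X) c' (s' : ℕ → ℕ) (A' : ℕ → Set X),
      (∀ k, s k ∈ phi c k) → (∀ k, τ (s k) (A k)) →
      (∀ k, s' k ∈ phi c' k) → (∀ k, τ (s' k) (A' k)) →
      (∀ p, SeqIncl r (s p) s') →
      ∀ u ∈ U c, ∀ u' ∈ U c', r u u')
  inter : ∃ I : ℕ →. ℕ, Nat.Partrec I ∧
    (∀ n₁ n₂ A₁ A₂, τ n₁ A₁ → τ n₂ A₂ → ∃ u ∈ I (Nat.pair n₁ n₂), τ u (A₁ ∩ A₂)) ∧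
    (∀ n₁ n₂ A₁ A₂ n₁' n₂' A₁' A₂', τ n₁ A₁ → τ n₂ A₂ → τ n₁' A₁' → τ n₂' A₂' →
      r n₁ n₁' → r n₂ n₂' →
      ∀ u ∈ I (Nat.pair n₁ n₂), ∀ u' ∈ I (Nat.pair n₁' n₂'), r u u')

/-- A Type 1 computable topological space with the actual inclusion relation as
formal inclusion (all monotonicity requirements are then automatic and omitted). -/
structure IsCTSIncl {X : Type*} (ν : ℕ →. X) (T : TopologicalSpace X)
    (τ : ℕ → Set X → Prop) : Prop where
  single : ∀ n A B, τ n A → τ n B → A = B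
  isOpen : ∀ n A, τ n A → T.IsOpen A
  generates : T = TopologicalSpace.generateFrom {A | ∃ n, τ n A}
  empty : ∃ n, τ n (∅ : Set X)
  univ : ∃ n, τ n (Set.univ : Set X)
  malcev : ∃ F : ℕ →. ℕ, Nat.Partrec F ∧ ∀ n A, τ n A → ∃ e ∈ F n, SemiDecName ν A e
  union : ∃ U : ℕ →. ℕ, Nat.Partrec U ∧
    ∀ c (s : ℕ → ℕ) (A : ℕ → Set X), (∀ k, s k ∈ phi c k) → (∀ k, τ (s k) (A k)) →
      ∃ u ∈ U c, τ u (⋃ k, A k)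
  inter : ∃ I : ℕ →. ℕ, Nat.Partrec I ∧
    ∀ n₁ n₂ A₁ A₂, τ n₁ A₁ → τ n₂ A₂ → ∃ u ∈ I (Nat.pair n₁ n₂), τ u (A₁ ∩ A₂)

/-- A Nogina basis for `(X, ν)` (with `ν` intended to be a numbering, i.e. onto). -/
structure IsNoginaBasis {X : Type*} (ν : ℕ →. X) (β : ℕ → Set X → Prop) : Prop where
  single : ∀ b B B', β b B → β b B' → B = B'
  semidec : ∃ F : ℕ →. ℕ, Nat.Partrec F ∧ ∀ b B, β b B → ∃ e ∈ F b, SemiDecName ν B e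
  point : ∃ G : ℕ →. ℕ, Nat.Partrec G ∧
    ∀ n x, x ∈ ν n → ∃ b ∈ G n, ∃ B, β b B ∧ x ∈ B
  inter : ∃ H : ℕ →. ℕ, Nat.Partrec H ∧
    ∀ b₁ b₂ B₁ B₂ n x, β b₁ B₁ → β b₂ B₂ → x ∈ ν n → x ∈ B₁ → x ∈ B₂ →
      ∃ b₃ ∈ H (Nat.pair (Nat.pair b₁ b₂) n), ∃ B₃, β b₃ B₃ ∧ x ∈ B₃ ∧ B₃ ⊆ B₁ ∩ B₂

/-- `p = ⟨e₁, e₂⟩` is a name of the open set `O` for the Nogina topology of the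
basis `β`: `e₁` witnesses semi-decidability of `O` and `e₂` computes, from a
`ν`-name of a point of `O`, a basic set containing the point and contained in `O`. -/
def NoginaName {X : Type*} (ν : ℕ →. X) (β : ℕ → Set X → Prop) (p : ℕ) (O : Set X) : Prop :=
  SemiDecName ν O p.unpair.1 ∧
  ∀ n x, x ∈ ν n → x ∈ O → ∃ b ∈ phi p.unpair.2 n, ∃ B, β b B ∧ x ∈ B ∧ B ⊆ O

/-- `i` is a name of `O` as a Lacombe set: `W i ⊆ dom β` and `O` is the union of
the basic sets named by elements of `W i`. -/
def LacombeName {X : Type*} (β : ℕ → Set X → Prop) (i : ℕ) (O : Set X) : Prop :=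
  (∀ k ∈ W i, ∃ B, β k B) ∧ O = ⋃ k ∈ W i, ⋃ B, ⋃ (_ : β k B), B

/-- A Lacombe basis for `(X, ν)`. -/
structure IsLacombeBasis {X : Type*} (ν : ℕ →. X) (β : ℕ → Set X → Prop) : Prop where
  single : ∀ b B B', β b B → β b B' → B = B'
  semidec : ∃ F : ℕ →. ℕ, Nat.Partrec F ∧ ∀ b B, β b B → ∃ e ∈ F b, SemiDecName ν B e
  point : ∀ x : X, ∃ b B, β b B ∧ x ∈ B
  cover : ∃ i, LacombeName β i (Set.univ : Set X)
  inter : ∃ H : ℕ →. ℕ, Nat.Partrec H ∧ ∀ b₁ b₂ B₁ B₂, β b₁ B₁ → β b₂ B₂ →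
    ∃ i ∈ H (Nat.pair b₁ b₂), LacombeName β i (B₁ ∩ B₂)

/-- A Spreen basis for `(X, ν)`, with formal inclusion relation `r`.  Computable
functions with values in `dom(β)^ℕ` are represented by partial computable
functions producing the `k`-th term of the sequence from the pair `⟨input, k⟩`. -/
structure IsSpreenBasis {X : Type*} (ν : ℕ →. X) (β : ℕ → Set X → Prop)
    (r : ℕ → ℕ → Prop) : Prop where
  single : ∀ b B B', β b B → β b B' → B = B'
  formal : IsFormalIncl β r
  semidec : ∃ F : ℕ →. ℕ, Nat.Partrec F ∧ ∀ b B, β b B → ∃ e ∈ F b, SemiDecName ν B e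
  dense : ∀ b B, β b B → B.Nonempty → ∃ n x, x ∈ ν n ∧ x ∈ B
  G1 : ∃ g : ℕ →. ℕ, Nat.Partrec g ∧
    (∀ n x, x ∈ ν n → ∃ s : ℕ → ℕ, (∀ k, s k ∈ g (Nat.pair n k)) ∧
      ∀ k, ∃ B, β (s k) B ∧ x ∈ B) ∧
    (∀ n m x (s t : ℕ → ℕ), x ∈ ν n → x ∈ ν m →
      (∀ k, s k ∈ g (Nat.pair n k)) → (∀ k, t k ∈ g (Nat.pair m k)) → SeqEquiv r s t) ∧
    (∀ x : X, ∃ b B, β b B ∧ x ∈ B ∧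
      ∀ n y, y ∈ ν n → y ∈ B → ∀ s : ℕ → ℕ, (∀ k, s k ∈ g (Nat.pair n k)) → SeqIncl r b s)
  G2 : ∃ g : ℕ →. ℕ, Nat.Partrec g ∧
    (∀ n x b₁ b₂ B₁ B₂, x ∈ ν n → β b₁ B₁ → β b₂ B₂ → x ∈ B₁ → x ∈ B₂ →
      ∃ s : ℕ → ℕ, (∀ k, s k ∈ g (Nat.pair (Nat.pair n (Nat.pair b₁ b₂)) k)) ∧
        ∀ k, ∃ B, β (s k) B ∧ x ∈ B ∧ B ⊆ B₁ ∩ B₂) ∧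
    (∀ n m x b₁ b₂ b₁' b₂' (s t : ℕ → ℕ), x ∈ ν n → x ∈ ν m → r b₁ b₁' → r b₂ b₂' →
      (∀ k, s k ∈ g (Nat.pair (Nat.pair n (Nat.pair b₁ b₂)) k)) →
      (∀ k, t k ∈ g (Nat.pair (Nat.pair m (Nat.pair b₁' b₂')) k)) → SeqIncl₂ r s t) ∧
    (∀ b₁ b₂ B₁ B₂, β b₁ B₁ → β b₂ B₂ → ∀ x, x ∈ B₁ → x ∈ B₂ →
      ∃ b₃ B₃, β b₃ B₃ ∧ x ∈ B₃ ∧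
        ∀ m y, y ∈ ν m → y ∈ B₃ → ∀ s : ℕ → ℕ,
          (∀ k, s k ∈ g (Nat.pair (Nat.pair m (Nat.pair b₁ b₂)) k)) → SeqIncl r b₃ s)

/-- `p = ⟨n, m⟩` is a name of the open set `O` for the Spreen topology of the
Spreen basis `(β, r)`. -/
def SpreenName {X : Type*} (ν : ℕ →. X) (β : ℕ → Set X → Prop) (r : ℕ → ℕ → Prop)
    (p : ℕ) (O : Set X) : Prop :=
  SemiDecName ν O p.unpair.1 ∧
  (∀ n x, x ∈ ν n → x ∈ O → ∃ s : ℕ → ℕ,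
      (∀ k, s k ∈ phi p.unpair.2 (Nat.pair n k)) ∧
      ∀ k, ∃ B, β (s k) B ∧ x ∈ B ∧ B ⊆ O) ∧
  (∀ n m x (s t : ℕ → ℕ), x ∈ ν n → x ∈ ν m → x ∈ O →
      (∀ k, s k ∈ phi p.unpair.2 (Nat.pair n k)) →
      (∀ k, t k ∈ phi p.unpair.2 (Nat.pair m k)) → SeqEquiv r s t) ∧
  (∀ x, x ∈ O → ∃ b B, β b B ∧ x ∈ B ∧
      ∀ n y, y ∈ ν n → y ∈ B → ∀ s : ℕ → ℕ,
        (∀ k, s k ∈ phi p.unpair.2 (Nat.pair n k)) → SeqIncl r b s)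

/-- The extension of the formal inclusion relation `r` to names of Spreen open sets. -/
def SpreenTauIncl {X : Type*} (ν : ℕ →. X) (r : ℕ → ℕ → Prop) (p q : ℕ) : Prop :=
  ∀ n ∈ ν.Dom, (phi p.unpair.1 n).Dom →
    (phi q.unpair.1 n).Dom ∧
    ∀ s t : ℕ → ℕ, (∀ k, s k ∈ phi p.unpair.2 (Nat.pair n k)) →
      (∀ k, t k ∈ phi q.unpair.2 (Nat.pair n k)) → SeqIncl₂ r s t

/-- A partial computable translation of Spreen names of open sets for the basis
`(β₁, r₁)` into Spreen names for the basis `(β₂, r₂)`, increasing with respect to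
the extended formal inclusion relations. -/
def SpreenTopTrans {X : Type*} (ν : ℕ →. X) (β₁ : ℕ → Set X → Prop) (r₁ : ℕ → ℕ → Prop)
    (β₂ : ℕ → Set X → Prop) (r₂ : ℕ → ℕ → Prop) : Prop :=
  ∃ h : ℕ →. ℕ, Nat.Partrec h ∧
    (∀ p O, SpreenName ν β₁ r₁ p O → ∃ q ∈ h p, SpreenName ν β₂ r₂ q O) ∧
    (∀ p p' O O', SpreenName ν β₁ r₁ p O → SpreenName ν β₁ r₁ p' O' →
      SpreenTauIncl ν r₁ p p' → ∀ q ∈ h p, ∀ q' ∈ h p', SpreenTauIncl ν r₂ q q')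

/-- Effective continuity between computable topological spaces, with the actual
inclusion relations as formal inclusions. -/
def EffContinuous {X Y : Type*} (T₁ : TopologicalSpace X) (T₂ : TopologicalSpace Y)
    (τ₁ : ℕ → Set X → Prop) (τ₂ : ℕ → Set Y → Prop) (f : X → Y) : Prop :=
  (@Continuous X Y T₁ T₂ f) ∧
  ∃ h : ℕ →. ℕ, Nat.Partrec h ∧ ∀ n O, τ₂ n O → ∃ m ∈ h n, τ₁ m (f ⁻¹' O)

/-- Effective continuity between computable topological spaces with formal
inclusion relations `r₁`, `r₂` on names of open sets. -/
def EffContinuousF {X Y : Type*} (T₁ : TopologicalSpace X) (T₂ : TopologicalSpace Y)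
    (τ₁ : ℕ → Set X → Prop) (τ₂ : ℕ → Set Y → Prop)
    (r₁ r₂ : ℕ → ℕ → Prop) (f : X → Y) : Prop :=
  (@Continuous X Y T₁ T₂ f) ∧
  ∃ h : ℕ →. ℕ, Nat.Partrec h ∧
    (∀ n O, τ₂ n O → ∃ m ∈ h n, τ₁ m (f ⁻¹' O)) ∧
    (∀ n₁ n₂ O₁ O₂, τ₂ n₁ O₁ → τ₂ n₂ O₂ → r₂ n₁ n₂ →
      ∀ m₁ ∈ h n₁, ∀ m₂ ∈ h n₂, r₁ m₁ m₂)

/-- `e` is a Cauchy name (`c_ℝ`-name) of the real number `x`. -/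
def CRealName (e : ℕ) (x : ℝ) : Prop :=
  ∀ n : ℕ, ∃ m ∈ phi e n, |((ratOfNat m : ℚ) : ℝ) - x| < (2 : ℝ) ^ (-(n : ℤ))

/-- `e` is a left (lower) name (`c_↗`-name) of the real number `x`: it computes a
nondecreasing sequence of rationals below `x` converging to `x`. -/
def LRealName (e : ℕ) (x : ℝ) : Prop :=
  ∃ s : ℕ → ℕ, (∀ n, s n ∈ phi e n) ∧
    (Monotone fun n => ratOfNat (s n)) ∧
    (∀ n, ((ratOfNat (s n) : ℚ) : ℝ) < x) ∧
    Filter.Tendsto (fun n => ((ratOfNat (s n) : ℚ) : ℝ)) Filter.atTop (nhds x)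

/-- `(X, ν, d)` is a (non-necessarily effectively separable) computable metric
space: the computable points are dense and the metric is `(ν×ν, c_ℝ)`-computable. -/
structure IsCMS {X : Type*} [MetricSpace X] (ν : ℕ →. X) : Prop where
  dense : Dense {x : X | ∃ n, x ∈ ν n}
  dist_comp : ∃ F : ℕ →. ℕ, Nat.Partrec F ∧
    ∀ n m x y, x ∈ ν n → y ∈ ν m → ∃ e ∈ F (Nat.pair n m), CRealName e (dist x y)

/-- The natural numbering of the open balls of a computable metric space, centered
at computable points with computable radii: `⟨n, m⟩` names `B(ν n, c_ℝ m)`. -/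
def ballName {X : Type*} [MetricSpace X] (ν : ℕ →. X) (p : ℕ) (B : Set X) : Prop :=
  ∃ x r, x ∈ ν p.unpair.1 ∧ CRealName p.unpair.2 r ∧ B = Metric.ball x r

/-- The natural formal inclusion relation on names of balls:
`(x, r₁) ⊆̊ (y, r₂)` iff `d(x, y) + r₁ ≤ r₂`. -/
def ballIncl {X : Type*} [MetricSpace X] (ν : ℕ →. X) (p q : ℕ) : Prop :=
  ∃ x y r s, x ∈ ν p.unpair.1 ∧ y ∈ ν q.unpair.1 ∧
    CRealName p.unpair.2 r ∧ CRealName q.unpair.2 s ∧ dist x y + r ≤ s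

/-- `f` is effectively metric continuous: from a name of a point `x` and a name of
`ε > 0` one can compute a name of some `η > 0` witnessing continuity at `x`. -/
def EffMetricContinuous {X Y : Type*} [MetricSpace X] [MetricSpace Y]
    (ν : ℕ →. X) (f : X → Y) : Prop :=
  ∃ H : ℕ →. ℕ, Nat.Partrec H ∧
    ∀ n x e ε, x ∈ ν n → CRealName e ε → (0:ℝ) < ε →
      ∃ m ∈ H (Nat.pair n e), ∃ η : ℝ, CRealName m η ∧ 0 < η ∧
        ∀ y : X, dist x y < η → dist (f x) (f y) < ε

/-- `(X, ν, d)` admits an algorithm of passage to the limit. -/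
def HasLimitAlg {X : Type*} [MetricSpace X] (ν : ℕ →. X) : Prop :=
  ∃ L : ℕ →. ℕ, Nat.Partrec L ∧
    ∀ c (s : ℕ → ℕ) (xs : ℕ → X) (x : X),
      (∀ k, s k ∈ phi c k) → (∀ k, xs k ∈ ν (s k)) →
      (∀ k m, k < m → dist (xs k) (xs m) < (2 : ℝ) ^ (-(k : ℤ))) →
      Filter.Tendsto xs Filter.atTop (nhds x) →
      ∃ p ∈ L c, x ∈ ν p

section Computability

theorem partrec₂_phi : Partrec₂ phi :=
  Nat.Partrec.Code.eval_part.comp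
    ((Computable.ofNat Nat.Partrec.Code).comp Computable.fst) Computable.snd

/-- The `s`-`m`-`n` theorem for the enumeration `phi`. -/
theorem exists_computable_phi_eq {α : Type*} [Primcodable α] {g : α → ℕ →. ℕ}
    (hg : Partrec₂ g) : ∃ s : α → ℕ, Computable s ∧ ∀ a n, phi (s a) n = g a n := by
  have hG : Partrec fun m : ℕ =>
      (Part.ofOption (Encodable.decode (α := α) m.unpair.1)).bind fun a => g a m.unpair.2 :=
    (Computable.ofOption (Computable.decode.comp (Computable.fst.comp Computable.unpair))).bind
      (hg.comp Computable.snd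
        (Computable.snd.comp (Computable.unpair.comp Computable.fst))).to₂
  obtain ⟨c, hc⟩ := Nat.Partrec.Code.exists_code.1 (Partrec.nat_iff.1 hG)
  obtain ⟨t, ht, hts⟩ := Nat.Partrec.Code.smn
  refine ⟨fun a => Encodable.encode (t c (Encodable.encode a)),
    Computable.encode.comp (ht.comp (Computable.const c) Computable.encode), fun a n => ?_⟩
  simp [phi, hts, hc]

theorem primrec₂_nat_pow : Primrec₂ fun a b : ℕ => a ^ b :=
  Primrec₂.unpaired'.1 Nat.Primrec.pow

theorem primrecRel_nat_coprime : PrimrecRel Nat.Coprime := by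
  have h : PrimrecRel fun (d : ℕ) (p : ℕ × ℕ) => ¬ (p.1 % d = 0 ∧ p.2 % d = 0 ∧ d ≠ 1) := by
    have hmod : ∀ {u : ℕ × ℕ × ℕ → ℕ}, Primrec u →
        PrimrecPred fun q : ℕ × ℕ × ℕ => u q % q.1 = 0 := fun hu =>
      Primrec.eq.comp (Primrec.nat_mod.comp hu Primrec.fst) (Primrec.const 0)
    exact ((hmod (Primrec.fst.comp Primrec.snd)).and
      ((hmod (Primrec.snd.comp Primrec.snd)).and
        (Primrec.eq.comp Primrec.fst (Primrec.const 1)).not)).not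
  have hlt : PrimrecPred fun p : ℕ × ℕ =>
      ∀ d < p.1 + p.2 + 1, ¬ (p.1 % d = 0 ∧ p.2 % d = 0 ∧ d ≠ 1) :=
    (h.forall_mem_list.comp (Primrec.list_range.comp
      (Primrec.succ.comp (Primrec.nat_add.comp Primrec.fst Primrec.snd))) Primrec.id).of_eq
      (by simp)
  have h0 : PrimrecPred fun p : ℕ × ℕ => ¬ (p.1 = 0 ∧ p.2 = 0) :=
    ((Primrec.eq.comp Primrec.fst (Primrec.const 0)).and
      (Primrec.eq.comp Primrec.snd (Primrec.const 0))).not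
  refine (hlt.and h0).of_eq fun p => ?_
  constructor
  · rintro ⟨hd, hne⟩
    by_contra hg
    refine hd (p.1.gcd p.2) ?_ ⟨Nat.mod_eq_zero_of_dvd (Nat.gcd_dvd_left _ _),
      Nat.mod_eq_zero_of_dvd (Nat.gcd_dvd_right _ _), hg⟩
    rcases Nat.eq_zero_or_pos p.1 with h1 | h1
    · rcases Nat.eq_zero_or_pos p.2 with h2 | h2
      · exact absurd ⟨h1, h2⟩ hne
      · have := Nat.gcd_le_right p.1 h2
        omega
    · have := Nat.gcd_le_left p.2 h1
      omega
  · rintro hc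
    refine ⟨fun d _ ⟨h1, h2, h3⟩ => h3 ?_, fun ⟨h1, h2⟩ => ?_⟩
    · exact Nat.eq_one_of_dvd_coprimes hc (Nat.dvd_of_mod_eq_zero h1) (Nat.dvd_of_mod_eq_zero h2)
    · simp [h1, h2] at hc

end Computability

section Rationals

theorem ratOfNat_surjective : Function.Surjective ratOfNat :=
  Encodable.surjective_decode_getD ℚ 0

/-- The codes at which `ratOfNat` does not take its default value. -/
def IsRatCode (k : ℕ) : Prop :=
  0 < k.unpair.2 ∧ (Equiv.intEquivNat.symm k.unpair.1).natAbs.Coprime k.unpair.2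

theorem ratOfNat_of_isRatCode {k : ℕ} (h : IsRatCode k) :
    ratOfNat k = (Equiv.intEquivNat.symm k.unpair.1 : ℚ) / (k.unpair.2 : ℚ) := by
  have hk : k = Encodable.encode (⟨Equiv.intEquivNat.symm k.unpair.1, k.unpair.2,
      h.1.ne', h.2⟩ : ℚ) := by
    change k = Nat.pair (Equiv.intEquivNat (Equiv.intEquivNat.symm k.unpair.1)) k.unpair.2
    simp
  conv_lhs => rw [hk]
  rw [ratOfNat, Encodable.encodek, Option.getD_some, ← Rat.num_div_den (Rat.mk' _ _ _ _)]

theorem ratOfNat_of_not_isRatCode {k : ℕ} (h : ¬ IsRatCode k) : ratOfNat k = 0 := by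
  have hk : Encodable.decode (α := ℚ) k = none := by
    have hs : Encodable.decode
        (α := Σ n : ℤ, { d : ℕ // 0 < d ∧ n.natAbs.Coprime d }) k = none := by
      rw [Encodable.decode_sigma_val]
      change Option.map _ (Encodable.decodeSubtype k.unpair.2) = none
      rw [Option.map_eq_none_iff]
      exact dif_neg h
    exact congrArg (fun o => Option.bind o _) hs
  rw [ratOfNat, hk, Option.getD_none]

theorem intEquivNat_symm_eq (a : ℕ) :
    Equiv.intEquivNat.symm a =
      ((if a % 2 = 0 then a / 2 else 0 : ℕ) : ℤ) - ((if a % 2 = 0 then 0 else a / 2 + 1 : ℕ) : ℤ) := by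
  rw [Equiv.symm_apply_eq]
  rcases Nat.mod_two_eq_zero_or_one a with h | h
  · simp only [h, if_true, Nat.cast_zero, sub_zero]
    change a = 2 * (a / 2)
    omega
  · simp only [h, one_ne_zero, if_false, Nat.cast_zero, zero_sub]
    rw [Nat.cast_succ, ← Int.negSucc_eq]
    change a = 2 * (a / 2) + 1
    omega

/-- `ratOfNat` is presented by primitive recursive fractions. -/
theorem exists_primrec_ratOfNat : ∃ P N D : ℕ → ℕ, Primrec P ∧ Primrec N ∧ Primrec D ∧
    ∀ k, 0 < D k ∧ ratOfNat k = ((P k : ℚ) - N k) / D k := by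
  let p : ℕ → ℕ := fun a => if a % 2 = 0 then a / 2 else 0
  let q : ℕ → ℕ := fun a => if a % 2 = 0 then 0 else a / 2 + 1
  have heven : PrimrecPred fun a : ℕ => a % 2 = 0 :=
    Primrec.eq.comp (Primrec.nat_mod.comp Primrec.id (Primrec.const 2)) (Primrec.const 0)
  have hhalf : Primrec fun a : ℕ => a / 2 := Primrec.nat_div.comp Primrec.id (Primrec.const 2)
  have hp : Primrec p := Primrec.ite heven hhalf (Primrec.const 0)
  have hq : Primrec q := Primrec.ite heven (Primrec.const 0) (Primrec.succ.comp hhalf)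
  have h1 : Primrec fun k : ℕ => k.unpair.1 := Primrec.fst.comp Primrec.unpair
  have h2 : Primrec fun k : ℕ => k.unpair.2 := Primrec.snd.comp Primrec.unpair
  have habs : ∀ a, (Equiv.intEquivNat.symm a).natAbs = p a + q a := by
    intro a
    rw [intEquivNat_symm_eq]
    simp only [p, q]
    split_ifs <;> omega
  have hcode : PrimrecPred IsRatCode := by
    refine ((Primrec.nat_lt.comp (Primrec.const 0) h2).and
      (primrecRel_nat_coprime.comp (Primrec.nat_add.comp (hp.comp h1) (hq.comp h1)) h2)).of_eq
      fun k => ?_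
    rw [IsRatCode, habs]
  classical
  refine ⟨fun k => if IsRatCode k then p k.unpair.1 else 0,
    fun k => if IsRatCode k then q k.unpair.1 else 0,
    fun k => if IsRatCode k then k.unpair.2 else 1,
    Primrec.ite hcode (hp.comp h1) (Primrec.const 0),
    Primrec.ite hcode (hq.comp h1) (Primrec.const 0),
    Primrec.ite hcode h2 (Primrec.const 1), fun k => ?_⟩
  by_cases h : IsRatCode k
  · simp only [h, if_true]
    refine ⟨h.1, ?_⟩
    rw [ratOfNat_of_isRatCode h, intEquivNat_symm_eq]
    simp only [Int.cast_sub, Int.cast_natCast, p, q]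
  · simp [h, ratOfNat_of_not_isRatCode h]

theorem exists_computable_ratOfNat_sub : ∃ s : ℕ → ℕ → ℕ, Computable₂ s ∧
    ∀ i j, ratOfNat (s i j) = ratOfNat i - ratOfNat j := by
  obtain ⟨P, N, D, hP, hN, hD, hr⟩ := exists_primrec_ratOfNat
  let R : ℕ × ℕ → ℕ → Prop := fun p k =>
    (P k * D p.1 + N p.1 * D k) * D p.2 + P p.2 * (D k * D p.1) =
      (P p.1 * D k + N k * D p.1) * D p.2 + N p.2 * (D k * D p.1)
  have hR : ∀ p k, R p k ↔ ratOfNat k = ratOfNat p.1 - ratOfNat p.2 := by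
    intro p k
    have hk : (D k : ℚ) ≠ 0 := by exact_mod_cast (hr k).1.ne'
    have h1 : (D p.1 : ℚ) ≠ 0 := by exact_mod_cast (hr p.1).1.ne'
    have h2 : (D p.2 : ℚ) ≠ 0 := by exact_mod_cast (hr p.2).1.ne'
    rw [(hr k).2, (hr p.1).2, (hr p.2).2, div_sub_div _ _ h1 h2,
      div_eq_div_iff hk (mul_ne_zero h1 h2)]
    change (_ : ℕ) = _ ↔ _
    rw [← @Nat.cast_inj ℚ]
    push_cast
    constructor <;> intro h <;> linear_combination h
  have hRp : PrimrecPred fun x : (ℕ × ℕ) × ℕ => R x.1 x.2 := by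
    have hk : Primrec fun x : (ℕ × ℕ) × ℕ => x.2 := Primrec.snd
    have h1 : Primrec fun x : (ℕ × ℕ) × ℕ => x.1.1 := Primrec.fst.comp Primrec.fst
    have h2 : Primrec fun x : (ℕ × ℕ) × ℕ => x.1.2 := Primrec.snd.comp Primrec.fst
    have hDD := Primrec.nat_mul.comp (hD.comp hk) (hD.comp h1)
    exact Primrec.eq.comp
      (Primrec.nat_add.comp
        (Primrec.nat_mul.comp
          (Primrec.nat_add.comp (Primrec.nat_mul.comp (hP.comp hk) (hD.comp h1))
            (Primrec.nat_mul.comp (hN.comp h1) (hD.comp hk))) (hD.comp h2))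
        (Primrec.nat_mul.comp (hP.comp h2) hDD))
      (Primrec.nat_add.comp
        (Primrec.nat_mul.comp
          (Primrec.nat_add.comp (Primrec.nat_mul.comp (hP.comp h1) (hD.comp hk))
            (Primrec.nat_mul.comp (hN.comp hk) (hD.comp h1))) (hD.comp h2))
        (Primrec.nat_mul.comp (hN.comp h2) hDD))
  classical
  have hsearch : Partrec fun p : ℕ × ℕ => Nat.rfind fun k => Part.some (decide (R p k)) :=
    Partrec.rfind hRp.decide.to_comp.partrec.to₂
  have hex : ∀ p : ℕ × ℕ, ∃ k, k ∈ Nat.rfind fun k => Part.some (decide (R p k)) := by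
    intro p
    obtain ⟨k, hk⟩ := ratOfNat_surjective (ratOfNat p.1 - ratOfNat p.2)
    exact Part.dom_iff_mem.1 (Nat.rfind_dom.2 ⟨k, by simpa using (hR p k).2 hk,
      fun _ => trivial⟩)
  choose s hs using hex
  refine ⟨fun i j => s (i, j), (hsearch.of_eq_tot hs).to₂, fun i j => (hR (i, j) _).1 ?_⟩
  simpa using Nat.rfind_spec (hs (i, j))

end Rationals

section Reals

theorem exists_computable_cRealName_sub : ∃ s : ℕ → ℕ → ℕ, Computable₂ s ∧
    ∀ a b x y, CRealName a x → CRealName b y → CRealName (s a b) (x - y) := by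
  obtain ⟨σ, hσ, hsub⟩ := exists_computable_ratOfNat_sub
  have hg : Partrec₂ fun (p : ℕ × ℕ) (n : ℕ) => (phi p.1 (n + 1)).bind fun i =>
      (phi p.2 (n + 1)).bind fun j => Part.some (σ i j) := by
    have hi : Partrec fun x : (ℕ × ℕ) × ℕ => phi x.1.1 (x.2 + 1) :=
      partrec₂_phi.comp (Computable.fst.comp Computable.fst) (Computable.succ.comp Computable.snd)
    have hj : Partrec fun x : ((ℕ × ℕ) × ℕ) × ℕ => phi x.1.1.2 (x.1.2 + 1) :=
      partrec₂_phi.comp (Computable.snd.comp (Computable.fst.comp Computable.fst))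
        (Computable.succ.comp (Computable.snd.comp Computable.fst))
    have hσ' : Partrec₂ fun (x : ((ℕ × ℕ) × ℕ) × ℕ) (j : ℕ) => Part.some (σ x.2 j) :=
      (hσ.comp (Computable.snd.comp Computable.fst) Computable.snd).partrec.to₂
    exact (hi.bind (hj.bind hσ').to₂).to₂
  obtain ⟨s, hs, hphi⟩ := exists_computable_phi_eq hg
  refine ⟨fun a b => s (a, b), hs.to₂, fun a b x y ha hb n => ?_⟩
  obtain ⟨i, hi, hxi⟩ := ha (n + 1)
  obtain ⟨j, hj, hyj⟩ := hb (n + 1)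
  refine ⟨σ i j, ?_, ?_⟩
  · rw [hphi]
    exact Part.mem_bind hi (Part.mem_bind hj (Part.mem_some _))
  · have h2 : (2 : ℝ) ^ (-(n : ℤ)) = 2 * (2 : ℝ) ^ (-((n + 1 : ℕ) : ℤ)) := by
      simp only [zpow_neg, zpow_natCast, pow_succ]
      field_simp
    rw [hsub, h2]
    push_cast at hxi hyj ⊢
    rw [abs_lt] at *
    constructor <;> linarith

/-- Positivity of computable reals is semi-decidable. -/
theorem exists_partrec_dom_iff_pos : ∃ S : ℕ →. ℕ, Partrec S ∧
    ∀ e x, CRealName e x → ((S e).Dom ↔ 0 < x) := by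
  obtain ⟨P, N, D, hP, hN, hD, hr⟩ := exists_primrec_ratOfNat
  let Q : ℕ → ℕ → Prop := fun n k => D k + N k * 2 ^ n < P k * 2 ^ n
  have hQ : ∀ n k, Q n k ↔ (2 : ℝ) ^ (-(n : ℤ)) < (ratOfNat k : ℝ) := by
    intro n k
    have hk : (0 : ℝ) < D k := by exact_mod_cast (hr k).1
    have h2 : (0 : ℝ) < 2 ^ n := by positivity
    rw [(hr k).2, zpow_neg, zpow_natCast]
    push_cast
    rw [inv_eq_one_div, div_lt_div_iff₀ h2 hk]
    change (_ : ℕ) < _ ↔ _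
    rw [← @Nat.cast_lt ℝ]
    push_cast
    constructor <;> intro h <;> linarith
  have hQp : PrimrecPred fun x : ℕ × ℕ => Q x.1 x.2 := by
    have h2 : Primrec fun x : ℕ × ℕ => 2 ^ x.1 :=
      primrec₂_nat_pow.comp (Primrec.const 2) Primrec.fst
    exact Primrec.nat_lt.comp
      (Primrec.nat_add.comp (hD.comp Primrec.snd)
        (Primrec.nat_mul.comp (hN.comp Primrec.snd) h2))
      (Primrec.nat_mul.comp (hP.comp Primrec.snd) h2)
  classical
  refine ⟨fun e => Nat.rfind fun n => (phi e n).map fun k => decide (Q n k),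
    Partrec.rfind (partrec₂_phi.map
      (hQp.decide.to_comp.comp ((Computable.snd.comp Computable.fst).pair Computable.snd)).to₂),
    fun e x he => ?_⟩
  refine Nat.rfind_dom.trans ?_
  constructor
  · rintro ⟨n, hn, -⟩
    obtain ⟨k, hk, hQk⟩ := (Part.mem_map_iff _).1 hn
    obtain ⟨k', hk', hx⟩ := he n
    obtain rfl := Part.mem_unique hk hk'
    have := (hQ n k).1 (of_decide_eq_true hQk)
    rw [abs_lt] at hx
    linarith
  · intro hx
    obtain ⟨n, hn⟩ := exists_pow_lt_of_lt_one (half_pos hx) (by norm_num : (1 / 2 : ℝ) < 1)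
    obtain ⟨k, hk, hxk⟩ := he n
    refine ⟨n, (Part.mem_map_iff _).2 ⟨k, hk, decide_eq_true ((hQ n k).2 ?_)⟩, fun _ => ?_⟩
    · rw [abs_lt] at hxk
      have : (2 : ℝ) ^ (-(n : ℤ)) = (1 / 2) ^ n := by simp
      linarith
    · obtain ⟨m, hm, -⟩ := he _
      exact Part.dom_iff_mem.2 ⟨_, Part.mem_map _ hm⟩

end Reals

section Metric

theorem NoginaName.isOpen {X : Type*} {ν : ℕ →. X} (hν : ∀ x : X, ∃ n, x ∈ ν n)
    {β : ℕ → Set X → Prop} {p : ℕ} {O : Set X} (h : NoginaName ν β p O) :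
    (TopologicalSpace.generateFrom {B | ∃ b, β b B}).IsOpen O := by
  let := TopologicalSpace.generateFrom {B | ∃ b, β b B}
  refine (isOpen_iff_forall_mem_open (s := O)).2 fun x hx => ?_
  obtain ⟨n, hn⟩ := hν x
  obtain ⟨b, -, B, hB, hxB, hBO⟩ := h.2 n x hn hx
  exact ⟨B, hBO, TopologicalSpace.isOpen_generateFrom_of_mem ⟨b, hB⟩, hxB⟩

variable {X : Type*} [MetricSpace X]

/-- Names of the open ball centered at a computable point with a computable radius, as an
open set of the metric Nogina topology, can be computed from names of the center and radius. -/
theorem IsCMS.exists_computable_noginaName_ball {ν : ℕ →. X} (h : IsCMS ν) :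
    ∃ t : ℕ → ℕ → ℕ, Computable₂ t ∧ ∀ j e x r, x ∈ ν j → CRealName e r →
      NoginaName ν (ballName ν) (t j e) (Metric.ball x r) := by
  obtain ⟨d, hd, hdist⟩ := h.dist_comp
  rw [← Partrec.nat_iff] at hd
  obtain ⟨s, hs, hsub⟩ := exists_computable_cRealName_sub
  obtain ⟨S, hS, hpos⟩ := exists_partrec_dom_iff_pos
  have hd' : Partrec fun x : (ℕ × ℕ) × ℕ => d (Nat.pair x.1.1 x.2) :=
    hd.comp (Primrec₂.natPair.to_comp.comp (Computable.fst.comp Computable.fst) Computable.snd)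
  have hs' : Computable fun x : ((ℕ × ℕ) × ℕ) × ℕ => s x.1.1.2 x.2 :=
    hs.comp (Computable.snd.comp (Computable.fst.comp Computable.fst)) Computable.snd
  have hg₁ : Partrec₂ fun (p : ℕ × ℕ) (i : ℕ) =>
      (d (Nat.pair p.1 i)).bind fun a => S (s p.2 a) := (hd'.bind (hS.comp hs').to₂).to₂
  have hg₂ : Partrec₂ fun (p : ℕ × ℕ) (i : ℕ) =>
      (d (Nat.pair p.1 i)).map fun a => Nat.pair i (s p.2 a) :=
    (hd'.map (Primrec₂.natPair.to_comp.comp (Computable.snd.comp Computable.fst) hs').to₂).to₂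
  obtain ⟨t₁, ht₁, hphi₁⟩ := exists_computable_phi_eq hg₁
  obtain ⟨t₂, ht₂, hphi₂⟩ := exists_computable_phi_eq hg₂
  refine ⟨fun j e => Nat.pair (t₁ (j, e)) (t₂ (j, e)), (Primrec₂.natPair.to_comp.comp ht₁ ht₂).to₂,
    fun j e x r hx hr => ⟨fun i y hy => ?_, fun i y hy hyx => ?_⟩⟩
  · obtain ⟨a, ha, hax⟩ := hdist j i x y hx hy
    rw [Nat.unpair_pair, hphi₁, Part.eq_some_iff.2 ha, Part.bind_some,
      hpos _ _ (hsub _ _ _ _ hr hax), sub_pos, Metric.mem_ball']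
  · obtain ⟨a, ha, hax⟩ := hdist j i x y hx hy
    rw [Metric.mem_ball'] at hyx
    refine ⟨Nat.pair i (s e a), ?_, Metric.ball y (r - dist x y),
      ⟨y, r - dist x y, by simpa using hy, by simpa using hsub _ _ _ _ hr hax, rfl⟩,
      Metric.mem_ball_self (sub_pos.2 hyx), Metric.ball_subset_ball' ?_⟩
    · rw [Nat.unpair_pair, hphi₂]
      exact Part.mem_map _ ha
    · rw [dist_comm y x, sub_add_cancel]

variable {Y : Type*} [MetricSpace Y] {ν : ℕ →. X} {μ : ℕ →. Y} {f : X → Y}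

theorem EffMetricContinuous.effContinuous_nogina (hY : IsCMS μ)
    (hν : ∀ x : X, ∃ n, x ∈ ν n) (hf : Computes ν μ f) (hc : EffMetricContinuous ν f) :
    EffContinuous
      (TopologicalSpace.generateFrom {B | ∃ b, ballName ν b B})
      (TopologicalSpace.generateFrom {B | ∃ b, ballName μ b B})
      (NoginaName ν (ballName ν)) (NoginaName μ (ballName μ)) f := by
  obtain ⟨t, -, hball⟩ := hY.exists_computable_noginaName_ball
  obtain ⟨d, hd, hdist⟩ := hY.dist_comp
  obtain ⟨s, hs, hsub⟩ := exists_computable_cRealName_sub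
  obtain ⟨F, hF, hFf⟩ := hf
  obtain ⟨H, hH, hmod⟩ := hc
  rw [← Partrec.nat_iff] at hd hF hH
  have hpair := Primrec₂.natPair.to_comp
  have hu₁ : Computable fun n : ℕ => n.unpair.1 := Computable.fst.comp Computable.unpair
  have hu₂ : Computable fun n : ℕ => n.unpair.2 := Computable.snd.comp Computable.unpair
  have hF' : Partrec fun x : ℕ × ℕ => F x.2 := hF.comp Computable.snd
  have hg₁ : Partrec₂ fun p i : ℕ => (F i).bind fun j => phi p.unpair.1 j :=
    (hF'.bind (partrec₂_phi.comp (hu₁.comp (Computable.fst.comp Computable.fst))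
      Computable.snd).to₂).to₂
  have hg₂ : Partrec₂ fun p i : ℕ => (F i).bind fun j => (phi p.unpair.2 j).bind fun b =>
      (d (Nat.pair b.unpair.1 j)).bind fun a =>
        (H (Nat.pair i (s b.unpair.2 a))).map fun m => Nat.pair i m := by
    have hb : Partrec fun x : (ℕ × ℕ) × ℕ => phi x.1.1.unpair.2 x.2 :=
      partrec₂_phi.comp (hu₂.comp (Computable.fst.comp Computable.fst)) Computable.snd
    have ha : Partrec fun x : ((ℕ × ℕ) × ℕ) × ℕ => d (Nat.pair x.2.unpair.1 x.1.2) :=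
      hd.comp (hpair.comp (hu₁.comp Computable.snd) (Computable.snd.comp Computable.fst))
    have hi : Computable fun x : (((ℕ × ℕ) × ℕ) × ℕ) × ℕ => x.1.1.1.2 :=
      Computable.snd.comp (Computable.fst.comp (Computable.fst.comp Computable.fst))
    have hm : Partrec fun x : (((ℕ × ℕ) × ℕ) × ℕ) × ℕ =>
        H (Nat.pair x.1.1.1.2 (s x.1.2.unpair.2 x.2)) :=
      hH.comp (hpair.comp hi
        (hs.comp (hu₂.comp (Computable.snd.comp Computable.fst)) Computable.snd))
    have hout : Partrec fun x : (((ℕ × ℕ) × ℕ) × ℕ) × ℕ =>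
        (H (Nat.pair x.1.1.1.2 (s x.1.2.unpair.2 x.2))).map fun m => Nat.pair x.1.1.1.2 m :=
      hm.map (hpair.comp (hi.comp Computable.fst) Computable.snd).to₂
    exact (hF'.bind (hb.bind (ha.bind hout.to₂).to₂).to₂).to₂
  obtain ⟨t₁, ht₁, hphi₁⟩ := exists_computable_phi_eq hg₁
  obtain ⟨t₂, ht₂, hphi₂⟩ := exists_computable_phi_eq hg₂
  have hpre : ∀ p O, NoginaName μ (ballName μ) p O →
      NoginaName ν (ballName ν) (Nat.pair (t₁ p) (t₂ p)) (f ⁻¹' O) := by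
    intro p O hO
    refine ⟨fun i x hx => ?_, fun i x hx hxO => ?_⟩
    · obtain ⟨j, hj, hfx⟩ := hFf i x hx
      rw [Nat.unpair_pair, hphi₁, Part.eq_some_iff.2 hj, Part.bind_some, hO.1 j _ hfx,
        Set.mem_preimage]
    · obtain ⟨j, hj, hfx⟩ := hFf i x hx
      obtain ⟨b, hb, B, ⟨y, r, hy, hr, rfl⟩, hxB, hBO⟩ := hO.2 j _ hfx hxO
      obtain ⟨a, ha, hax⟩ := hdist _ j y (f x) hy hfx
      rw [Metric.mem_ball'] at hxB
      obtain ⟨m, hm, η, hmη, hη, hcont⟩ :=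
        hmod i x _ _ hx (hsub _ _ _ _ hr hax) (sub_pos.2 hxB)
      refine ⟨Nat.pair i m, ?_, Metric.ball x η,
        ⟨x, η, by simpa using hx, by simpa using hmη, rfl⟩, Metric.mem_ball_self hη,
        fun z hz => hBO (Metric.mem_ball'.2 ?_)⟩
      · rw [Nat.unpair_pair, hphi₂]
        exact Part.mem_bind hj (Part.mem_bind hb (Part.mem_bind ha (Part.mem_map _ hm)))
      · have h1 := hcont z (Metric.mem_ball'.1 hz)
        have h2 := dist_triangle y (f x) (f z)
        linarith
  refine ⟨continuous_generateFrom_iff.2 ?_, fun p => Part.some (Nat.pair (t₁ p) (t₂ p)),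
    Partrec.nat_iff.1 (hpair.comp ht₁ ht₂).partrec,
    fun p O hO => ⟨_, Part.mem_some _, hpre p O hO⟩⟩
  rintro _ ⟨b, y, r, hy, hr, rfl⟩
  exact (hpre _ _ (hball _ _ _ _ hy hr)).isOpen hν

theorem EffContinuous.effMetricContinuous {T₁ : TopologicalSpace X} {T₂ : TopologicalSpace Y}
    (hX : IsCMS ν) (hY : IsCMS μ) (hf : Computes ν μ f)
    (hc : EffContinuous T₁ T₂ (NoginaName ν (ballName ν)) (NoginaName μ (ballName μ)) f) :
    EffMetricContinuous ν f := by
  obtain ⟨t, ht, hball⟩ := hY.exists_computable_noginaName_ball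
  obtain ⟨d, hd, hdist⟩ := hX.dist_comp
  obtain ⟨s, hs, hsub⟩ := exists_computable_cRealName_sub
  obtain ⟨F, hF, hFf⟩ := hf
  obtain ⟨-, h, hh, hpre⟩ := hc
  rw [← Partrec.nat_iff] at hd hF hh
  have hpair := Primrec₂.natPair.to_comp
  have hu₁ : Computable fun n : ℕ => n.unpair.1 := Computable.fst.comp Computable.unpair
  have hu₂ : Computable fun n : ℕ => n.unpair.2 := Computable.snd.comp Computable.unpair
  have hH : Partrec fun p : ℕ => (F p.unpair.1).bind fun j => (h (t j p.unpair.2)).bind fun q =>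
      (phi q.unpair.2 p.unpair.1).bind fun b =>
        (d (Nat.pair b.unpair.1 p.unpair.1)).map fun a => s b.unpair.2 a := by
    have hq : Partrec fun x : ℕ × ℕ => h (t x.2 x.1.unpair.2) :=
      hh.comp (ht.comp Computable.snd (hu₂.comp Computable.fst))
    have hb : Partrec fun x : (ℕ × ℕ) × ℕ => phi x.2.unpair.2 x.1.1.unpair.1 :=
      partrec₂_phi.comp (hu₂.comp Computable.snd)
        (hu₁.comp (Computable.fst.comp Computable.fst))
    have ha : Partrec fun x : ((ℕ × ℕ) × ℕ) × ℕ =>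
        d (Nat.pair x.2.unpair.1 x.1.1.1.unpair.1) :=
      hd.comp (hpair.comp (hu₁.comp Computable.snd)
        (hu₁.comp (Computable.fst.comp (Computable.fst.comp Computable.fst))))
    have hout : Partrec fun x : ((ℕ × ℕ) × ℕ) × ℕ =>
        (d (Nat.pair x.2.unpair.1 x.1.1.1.unpair.1)).map fun a => s x.2.unpair.2 a :=
      ha.map (hs.comp (hu₂.comp (Computable.snd.comp Computable.fst)) Computable.snd).to₂
    exact (hF.comp hu₁).bind (hq.bind (hb.bind hout.to₂).to₂).to₂
  refine ⟨_, Partrec.nat_iff.1 hH, fun n x e ε hx he hε => ?_⟩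
  obtain ⟨j, hj, hfx⟩ := hFf n x hx
  obtain ⟨q, hq, hqO⟩ := hpre _ _ (hball j e (f x) ε hfx he)
  obtain ⟨b, hb, B, ⟨c, r, hcn, hr, rfl⟩, hxB, hBO⟩ := hqO.2 n x hx (Metric.mem_ball_self hε)
  obtain ⟨a, ha, hax⟩ := hdist _ n c x hcn hx
  refine ⟨s b.unpair.2 a, ?_, r - dist c x, hsub _ _ _ _ hr hax,
    sub_pos.2 (Metric.mem_ball'.1 hxB), fun y hy => ?_⟩
  · simp only [Nat.unpair_pair]
    exact Part.mem_bind hj (Part.mem_bind hq (Part.mem_bind hb (Part.mem_map _ ha)))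
  · have h1 := dist_triangle c x y
    exact Metric.mem_ball'.1 (hBO (Metric.mem_ball'.2 (by linarith)))

end Metric

/-- For a `(ν,μ)`-computable function between computable metric
spaces* with onto subnumberings, effective metric continuity is equivalent to
effective continuity with respect to the metric Nogina topologies (the Nogina
topologies generated by the open balls, with actual inclusions as formal
inclusions). -/
theorem effMetricContinuous_iff_effContinuous_nogina
    {X Y : Type*} [MetricSpace X] [MetricSpace Y]
    (ν : ℕ →. X) (μ : ℕ →. Y)
    (hX : IsCMS ν) (hY : IsCMS μ)
    (hν : ∀ x : X, ∃ n, x ∈ ν n) (hμ : ∀ y : Y, ∃ n, y ∈ μ n)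
    (f : X → Y) (hf : Computes ν μ f) :
    EffMetricContinuous ν f ↔
      EffContinuous
        (TopologicalSpace.generateFrom {B | ∃ b, ballName ν b B})
        (TopologicalSpace.generateFrom {B | ∃ b, ballName μ b B})
        (NoginaName ν (ballName ν)) (NoginaName μ (ballName μ)) f :=
  ⟨fun h => h.effContinuous_nogina hY hν hf, fun h => h.effMetricContinuous hX hY hf⟩

end T1
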